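/- Let G be a finite bipartite multigraph. The set of extreme points of the convex set 𝖫_G (of nonnegative solutions of L_G) is exactly { t_M | M a perfect matching of G }; in other words, the vertices of the polytope 𝖫_G are precisely the points associated to perfect matchings. -/

import Mathlib

open Finset

variable {Vp Vn E : Type*} [Fintype Vp] [Fintype Vn] [Fintype E]
  [DecidableEq Vp] [DecidableEq Vn] [DecidableEq E]

/-- `t : E → ℝ` solves the linear system `L_G`: at every positive vertex `v` the
weights of the edges incident to `v` sum to `2`, and similarly for negative vertices. -/
def SolvesLG (p : E → Vp) (q : E → Vn) (t : E → ℝ) : Prop :=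
  (∀ v : Vp, ∑ e ∈ Finset.univ.filter (fun e => p e = v), t e = 2) ∧
  (∀ v : Vn, ∑ e ∈ Finset.univ.filter (fun e => q e = v), t e = 2)

/-- The set `𝖫_G` of nonnegative solutions of `L_G`. -/
def LGset (p : E → Vp) (q : E → Vn) : Set (E → ℝ) :=
  {t | SolvesLG p q t ∧ ∀ e, 0 ≤ t e}

/-- `M` is a perfect matching of `G`: every positive vertex is the `p`-endpoint of
exactly one edge of `M`, and every negative vertex is the `q`-endpoint of exactly one
edge of `M`. -/
def IsPerfectMatching (p : E → Vp) (q : E → Vn) (M : Set E) : Prop :=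
  (∀ v : Vp, ∃! e, e ∈ M ∧ p e = v) ∧ (∀ v : Vn, ∃! e, e ∈ M ∧ q e = v)

/-- The point `t_M` associated to a perfect matching `M`: value `2` on edges of `M`
and `0` elsewhere. -/
noncomputable def tM (M : Set E) : E → ℝ := M.indicator fun _ => 2

section Fibers

variable {V : Type*} [DecidableEq V]

/-- If the weights sum to `2` on every fiber of `f`, then they sum to `2 * #A` on the preimage
of `A`. -/
lemma sum_filter_mem_eq_two_mul_card {f : E → V} {t : E → ℝ}
    (h : ∀ v, ∑ e ∈ univ.filter (fun e => f e = v), t e = 2) (A : Finset V) :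
    ∑ e ∈ univ.filter (fun e => f e ∈ A), t e = 2 * #A := by
  rw [← sum_fiberwise_of_maps_to (s := univ.filter (fun e => f e ∈ A)) (t := A) (g := f)
    (by simp)]
  have hfiber : ∀ v ∈ A,
      ∑ e ∈ (univ.filter (fun e => f e ∈ A)).filter (fun e => f e = v), t e = 2 := by
    intro v hv
    rw [← h v, filter_filter]
    congr 1
    ext e
    simp only [mem_filter, mem_univ, true_and]
    exact ⟨fun he => he.2, fun he => ⟨he ▸ hv, he⟩⟩
  rw [sum_congr rfl hfiber]
  simp [mul_comm]

/-- If `M` meets the fiber of `f` through `e ∈ M` only in `e`, then the sum over that fiber of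
weights vanishing outside `M` is the weight of `e`. -/
lemma sum_fiber_eq_of_support_subset {f : E → V} {M : Set E} {x : E → ℝ}
    (hx : ∀ e, e ∉ M → x e = 0) {e : E} (h : ∃! e', e' ∈ M ∧ f e' = f e) (he : e ∈ M) :
    ∑ e' ∈ univ.filter (fun e' => f e' = f e), x e' = x e := by
  refine sum_eq_single_of_mem e (by simp) fun e' he' hne => hx e' fun hM => hne ?_
  exact h.unique ⟨hM, (mem_filter.1 he').2⟩ ⟨he, rfl⟩

lemma sum_fiber_tM {f : E → V} {M : Set E} (h : ∀ v, ∃! e, e ∈ M ∧ f e = v) (v : V) :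
    ∑ e ∈ univ.filter (fun e => f e = v), tM M e = 2 := by
  obtain ⟨e, ⟨he, rfl⟩, -⟩ := h v
  rw [sum_fiber_eq_of_support_subset (M := M) (fun e he => by simp [tM, he]) (h _) he]
  simp [tM, he]

end Fibers

lemma tM_nonneg (M : Set E) (e : E) : 0 ≤ tM M e :=
  Set.indicator_nonneg (fun _ _ => zero_le_two) e

lemma IsPerfectMatching.tM_mem_LGset {p : E → Vp} {q : E → Vn} {M : Set E}
    (hM : IsPerfectMatching p q M) : tM M ∈ LGset p q :=
  ⟨⟨sum_fiber_tM hM.1, sum_fiber_tM hM.2⟩, tM_nonneg M⟩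

lemma IsPerfectMatching.eq_tM {p : E → Vp} {q : E → Vn} {M : Set E}
    (hM : IsPerfectMatching p q M) {x : E → ℝ} (hx : SolvesLG p q x)
    (hsupp : ∀ e, e ∉ M → x e = 0) : x = tM M := by
  funext e
  by_cases he : e ∈ M
  · rw [← sum_fiber_eq_of_support_subset hsupp (hM.1 (p e)) he, hx.1]
    simp [tM, he]
  · simp [tM, he, hsupp e he]

lemma IsPerfectMatching.tM_mem_extremePoints {p : E → Vp} {q : E → Vn} {M : Set E}
    (hM : IsPerfectMatching p q M) : tM M ∈ Set.extremePoints ℝ (LGset p q) := by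
  refine ⟨hM.tM_mem_LGset, fun x hx y hy hxy => hM.eq_tM hx.1 fun e he => ?_⟩
  obtain ⟨a, b, ha, hb, -, hab⟩ := hxy
  have hsum : a * x e + b * y e = 0 := by simpa [tM, he] using congrFun hab e
  have hax : a * x e = 0 :=
    ((add_eq_zero_iff_of_nonneg (mul_nonneg ha.le (hx.2 e)) (mul_nonneg hb.le (hy.2 e))).1 hsum).1
  exact (mul_eq_zero.1 hax).resolve_left ha.ne'

/-- The support of a nonnegative solution of `L_G` contains a perfect matching. -/
lemma exists_isPerfectMatching_pos {p : E → Vp} {q : E → Vn} {t : E → ℝ}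
    (ht : t ∈ LGset p q) : ∃ M : Set E, IsPerfectMatching p q M ∧ ∀ e ∈ M, 0 < t e := by
  obtain ⟨⟨hp, hq⟩, hnonneg⟩ := ht
  let N (v : Vp) : Finset Vn := (univ.filter (fun e => p e = v ∧ t e ≠ 0)).image q
  have hall (A : Finset Vp) : #A ≤ #(A.biUnion N) := by
    have hle : ∑ e ∈ univ.filter (fun e => p e ∈ A), t e ≤
        ∑ e ∈ univ.filter (fun e => q e ∈ A.biUnion N), t e := by
      rw [← sum_filter_ne_zero]
      refine sum_le_sum_of_subset_of_nonneg (fun e he => ?_) fun e _ _ => hnonneg e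
      simp only [mem_filter, mem_univ, true_and] at he
      simp only [mem_filter, mem_univ, true_and, mem_biUnion]
      exact ⟨p e, he.1, mem_image_of_mem q (by simp [he.2])⟩
    rw [sum_filter_mem_eq_two_mul_card hp, sum_filter_mem_eq_two_mul_card hq] at hle
    exact_mod_cast le_of_mul_le_mul_left hle two_pos
  obtain ⟨g, hginj, hg⟩ := (all_card_le_biUnion_card_iff_exists_injective N).1 hall
  have hcard : Fintype.card Vp = Fintype.card Vn := by
    have h₁ := sum_filter_mem_eq_two_mul_card hp univ
    have h₂ := sum_filter_mem_eq_two_mul_card hq univ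
    simp only [mem_univ, filter_true, card_univ] at h₁ h₂
    exact_mod_cast mul_left_cancel₀ two_ne_zero (h₁.symm.trans h₂)
  have hgbij := (Fintype.bijective_iff_injective_and_card g).2 ⟨hginj, hcard⟩
  have hedge (v : Vp) : ∃ e, (p e = v ∧ t e ≠ 0) ∧ q e = g v := by
    simpa [N] using hg v
  choose m hm hqm using hedge
  refine ⟨Set.range m, ⟨fun v => ⟨m v, ⟨⟨v, rfl⟩, (hm v).1⟩, ?_⟩, fun w => ?_⟩, ?_⟩
  · rintro _ ⟨⟨u, rfl⟩, hu⟩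
    rw [← hu, (hm u).1]
  · obtain ⟨v, rfl⟩ := hgbij.2 w
    refine ⟨m v, ⟨⟨v, rfl⟩, hqm v⟩, ?_⟩
    rintro _ ⟨⟨u, rfl⟩, hu⟩
    rw [hginj ((hqm u).symm.trans hu)]
  · rintro _ ⟨v, rfl⟩
    exact (hnonneg _).lt_of_ne' (hm v).2

lemma exists_pos_lt_one_mul_tM_le {M : Set E} {t : E → ℝ} (hnonneg : ∀ e, 0 ≤ t e)
    (hpos : ∀ e ∈ M, 0 < t e) : ∃ ε : ℝ, 0 < ε ∧ ε < 1 ∧ ∀ e, ε * tM M e ≤ t e := by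
  have hle : ∀ᶠ ε in nhdsWithin (0 : ℝ) (Set.Ioi 0), ∀ e, ε * tM M e ≤ t e := by
    refine Filter.eventually_all.2 fun e => ?_
    by_cases he : e ∈ M
    · filter_upwards [Ioo_mem_nhdsGT (half_pos (hpos e he))] with ε hε
      simp only [tM, he, Set.indicator_of_mem]
      linarith [hε.2]
    · simp [tM, he, hnonneg e]
  obtain ⟨ε, hε, hε'⟩ := (hle.and (Ioo_mem_nhdsGT one_pos)).exists
  exact ⟨ε, hε'.1, hε'.2, hε⟩

lemma exists_isPerfectMatching_eq_tM_of_mem_extremePoints {p : E → Vp} {q : E → Vn}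
    {t : E → ℝ} (ht : t ∈ Set.extremePoints ℝ (LGset p q)) :
    ∃ M : Set E, IsPerfectMatching p q M ∧ t = tM M := by
  obtain ⟨M, hM, hpos⟩ := exists_isPerfectMatching_pos ht.1
  obtain ⟨ε, hε, hε1, hle⟩ := exists_pos_lt_one_mul_tM_le ht.1.2 hpos
  have h1ε : 0 < 1 - ε := sub_pos.2 hε1
  let s : E → ℝ := (1 - ε)⁻¹ • (t - ε • tM M)
  have hs : s ∈ LGset p q := by
    refine ⟨⟨fun v => ?_, fun v => ?_⟩, fun e => ?_⟩
    · simp only [s, Pi.smul_apply, Pi.sub_apply, smul_eq_mul, ← mul_sum, sum_sub_distrib,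
        ht.1.1.1 v, hM.tM_mem_LGset.1.1 v]
      field_simp
    · simp only [s, Pi.smul_apply, Pi.sub_apply, smul_eq_mul, ← mul_sum, sum_sub_distrib,
        ht.1.1.2 v, hM.tM_mem_LGset.1.2 v]
      field_simp
    · exact mul_nonneg (inv_nonneg.2 h1ε.le) (sub_nonneg.2 (hle e))
  have hseg : t ∈ openSegment ℝ (tM M) s :=
    ⟨ε, 1 - ε, hε, h1ε, by ring, by simp [s, smul_smul, h1ε.ne']⟩
  exact ⟨M, hM, (ht.2 hM.tM_mem_LGset hs hseg).symm⟩

/-- The extreme points of the convex set `𝖫_G` are exactly the points associated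
to perfect matchings of `G`. -/
theorem extremePoints_LGset (p : E → Vp) (q : E → Vn) :
    Set.extremePoints ℝ (LGset p q) =
      {t : E → ℝ | ∃ M : Set E, IsPerfectMatching p q M ∧ t = tM M} := by
  ext t
  refine ⟨exists_isPerfectMatching_eq_tM_of_mem_extremePoints, ?_⟩
  rintro ⟨M, hM, rfl⟩
  exact hM.tM_mem_extremePoints
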